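/- Let f : S^n → ℝ be convex and differentiable on the spectrahedron Δ = {X ∈ S^n : X positive semidefinite, Tr(X) = 1}, with gradient L-Lipschitz on Δ (with respect to the Frobenius norm), and let D be the diameter of Δ in the Frobenius norm. Define a sequence by choosing a unit vector v_0 ∈ ℝ^n, setting X_0 = v_0v_0ᵀ, and for each k ≥ 0 choosing a unit eigenvector v_k of ∇f(X_k) associated with its smallest eigenvalue and setting X_{k+1} = (1 − γ_k) X_k + γ_k v_kv_kᵀ with γ_k = 2/(k+2). Then for every k ≥ 1: X_k is positive semidefinite, Tr(X_k) = 1, rank(X_k) ≤ k + 1, and f(X_k) − min_{X ∈ Δ} f(X) ≤ 2LD²/(k+2). -/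

import Mathlib

open Matrix

attribute [local instance] Matrix.frobeniusNormedAddCommGroup Matrix.frobeniusNormedSpace

/-- The Frobenius norm of a real `n × n` matrix. -/
noncomputable def frobNorm (n : ℕ) (X : Matrix (Fin n) (Fin n) ℝ) : ℝ :=
  Real.sqrt (∑ i, ∑ j, (X i j) ^ 2)

/-- The spectrahedron `Δ = {X ∈ Sⁿ : X ⪰ 0, Tr(X) = 1}`. -/
def spectrahedron (n : ℕ) : Set (Matrix (Fin n) (Fin n) ℝ) :=
  {X | X.PosSemidef ∧ X.trace = 1}

lemma hz_frob_eq (n : ℕ) (A : Matrix (Fin n) (Fin n) ℝ) : frobNorm n A = ‖A‖ := by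
  rw [frobenius_norm_def, frobNorm, Real.sqrt_eq_rpow]
  simp

lemma hz_trace_mul_le (n : ℕ) (A B : Matrix (Fin n) (Fin n) ℝ) :
    (A * B).trace ≤ frobNorm n A * frobNorm n B := by
  have hB : frobNorm n B = frobNorm n Bᵀ := by
    rw [hz_frob_eq, hz_frob_eq, frobenius_norm_transpose]
  rw [hB]
  have h := Real.sum_mul_le_sqrt_mul_sqrt (Finset.univ : Finset (Fin n × Fin n))
    (fun p => A p.1 p.2) (fun p => Bᵀ p.1 p.2)
  simp only [Fintype.sum_prod_type] at h
  simpa [Matrix.trace, Matrix.mul_apply, frobNorm] using h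

lemma hz_factor {n : ℕ} {Z : Matrix (Fin n) (Fin n) ℝ} (hZ : Z.PosSemidef) :
    ∃ B : Matrix (Fin n) (Fin n) ℝ, Z = Bᴴ * B := by
  open scoped MatrixOrder in
  obtain ⟨B, hB⟩ := CStarAlgebra.nonneg_iff_eq_star_mul_self.mp hZ.nonneg
  exact ⟨B, hB⟩

lemma hz_norm_le_one {n : ℕ} {Z : Matrix (Fin n) (Fin n) ℝ} (hZ : Z ∈ spectrahedron n) :
    ‖Z‖ ≤ 1 := by
  obtain ⟨h1, h2⟩ := hZ
  obtain ⟨B, rfl⟩ := hz_factor h1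
  have h3 : ‖B‖ * ‖B‖ = 1 := by
    rw [← hz_frob_eq, frobNorm, Real.mul_self_sqrt (by positivity), ← h2]
    simp only [Matrix.trace, Matrix.diag, Matrix.mul_apply, conjTranspose_apply, star_trivial]
    rw [Finset.sum_comm]
    simp [sq]
  calc ‖Bᴴ * B‖ ≤ ‖Bᴴ‖ * ‖B‖ := frobenius_norm_mul _ _
    _ = 1 := by rw [frobenius_norm_conjTranspose, h3]

lemma hz_trace_nonneg {n : ℕ} {A Z : Matrix (Fin n) (Fin n) ℝ} (hA : A.PosSemidef)
    (hZ : Z.PosSemidef) : 0 ≤ (A * Z).trace := by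
  obtain ⟨B, rfl⟩ := hz_factor hZ
  have := (hA.mul_mul_conjTranspose_same B).trace_nonneg
  rwa [Matrix.trace_mul_comm, ← Matrix.mul_assoc, Matrix.trace_mul_comm, ← Matrix.mul_assoc,
    Matrix.mul_assoc] at this

lemma hz_lam_le {n : ℕ} {A Z : Matrix (Fin n) (Fin n) ℝ} (hA : A.IsSymm) {l : ℝ}
    (hl : ∀ t : ℝ, ∀ u : Fin n → ℝ, u ≠ 0 → A *ᵥ u = t • u → l ≤ t)
    (hZ : Z ∈ spectrahedron n) : l ≤ (A * Z).trace := by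
  have hH : (A - l • (1 : Matrix (Fin n) (Fin n) ℝ)).IsHermitian := by
    unfold Matrix.IsHermitian
    rw [conjTranspose_eq_transpose_of_trivial, transpose_sub, hA.eq]
    simp
  have hP : (A - l • (1 : Matrix (Fin n) (Fin n) ℝ)).PosSemidef := by
    rw [hH.posSemidef_iff_eigenvalues_nonneg]
    intro i
    have h1 := hH.mulVec_eigenvectorBasis i
    have h2 := hl (hH.eigenvalues i + l) (hH.eigenvectorBasis i) (by
      intro h0
      apply hH.eigenvectorBasis.toBasis.ne_zero i
      simp only [OrthonormalBasis.coe_toBasis]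
      ext j
      exact congrFun h0 j) (by
      rw [sub_mulVec, smul_mulVec, one_mulVec] at h1
      rw [add_smul, ← h1]
      simp)
    simpa using h2
  have h := hz_trace_nonneg hP hZ.1
  rw [Matrix.sub_mul, trace_sub, smul_mul, Matrix.one_mul, trace_smul, hZ.2] at h
  simpa using h

lemma hz_convex (n : ℕ) : Convex ℝ (spectrahedron n) := by
  intro A hA B hB a b ha hb hab
  refine ⟨(hA.1.smul ha).add (hB.1.smul hb), ?_⟩
  rw [trace_add, trace_smul, trace_smul, hA.2, hB.2]
  simpa using hab

lemma hz_vec_mem {n : ℕ} {v : Fin n → ℝ} (hv : ∑ i, (v i) ^ 2 = 1) :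
    vecMulVec v v ∈ spectrahedron n := by
  refine ⟨by simpa using posSemidef_vecMulVec_self_star v, ?_⟩
  rw [← hv]
  simp [Matrix.trace, vecMulVec_apply, sq]

lemma hz_rank {n : ℕ} (A : Matrix (Fin n) (Fin n) ℝ) (a b : ℝ) (v : Fin n → ℝ) :
    (a • A + b • vecMulVec v v).rank ≤ A.rank + 1 := by
  have h : LinearMap.range (a • A + b • vecMulVec v v).mulVecLin ≤
      LinearMap.range A.mulVecLin ⊔ Submodule.span ℝ {v} := by
    rintro _ ⟨x, rfl⟩
    rw [mulVecLin_apply, add_mulVec, smul_mulVec, smul_mulVec, vecMulVec_mulVec]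
    refine Submodule.add_mem_sup (Submodule.smul_mem _ _ ⟨x, rfl⟩) (Submodule.smul_mem _ _ ?_)
    refine Submodule.mem_span_singleton.2 ⟨v ⬝ᵥ x, ?_⟩
    ext i
    simp [mul_comm]
  calc (a • A + b • vecMulVec v v).rank ≤ _ := Submodule.finrank_mono h
    _ ≤ _ := Submodule.finrank_add_le_finrank_add_finrank _ _
    _ ≤ A.rank + 1 := by
      gcongr
      · exact le_rfl
      · simpa using finrank_span_le_card (R := ℝ) ({v} : Set (Fin n → ℝ))

lemma hz_deriv {n : ℕ} {f : Matrix (Fin n) (Fin n) ℝ → ℝ} {G A d : Matrix (Fin n) (Fin n) ℝ}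
    {t : ℝ} (h : HasFDerivAt f
      (LinearMap.toContinuousLinearMap
        ((Matrix.traceLinearMap (Fin n) ℝ ℝ).comp (LinearMap.mulLeft ℝ G))) (A + t • d)) :
    HasDerivAt (fun s : ℝ => f (A + s • d)) ((G * d).trace) t := by
  have h1 : HasDerivAt (fun s : ℝ => A + s • d) d t := by
    have h2 := ((hasDerivAt_id t).smul_const d).const_add A
    rw [one_smul] at h2
    exact h2
  exact h.comp_hasDerivAt t h1

lemma hz_line_mem {n : ℕ} {A B : Matrix (Fin n) (Fin n) ℝ} (hA : A ∈ spectrahedron n)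
    (hB : B ∈ spectrahedron n) {t : ℝ} (ht : t ∈ Set.Icc (0 : ℝ) 1) :
    A + t • (B - A) ∈ spectrahedron n :=
  (hz_convex n).add_smul_sub_mem hA hB ht

lemma hz_first_order {n : ℕ} {f : Matrix (Fin n) (Fin n) ℝ → ℝ}
    {A B G : Matrix (Fin n) (Fin n) ℝ} (hconv : ConvexOn ℝ (spectrahedron n) f)
    (hA : A ∈ spectrahedron n) (hB : B ∈ spectrahedron n)
    (h : HasFDerivAt f
      (LinearMap.toContinuousLinearMap
        ((Matrix.traceLinearMap (Fin n) ℝ ℝ).comp (LinearMap.mulLeft ℝ G))) A) :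
    f A + (G * (B - A)).trace ≤ f B := by
  have hc : ConvexOn ℝ (Set.Icc (0 : ℝ) 1) (fun s : ℝ => f (A + s • (B - A))) := by
    refine ⟨convex_Icc _ _, ?_⟩
    intro x hx y hy a b ha hb hab
    have := hconv.2 (hz_line_mem hA hB hx) (hz_line_mem hA hB hy) ha hb hab
    convert this using 2
    have hb' : b = 1 - a := by linarith
    subst hb'
    simp only [smul_eq_mul]
    module
  have hd : HasDerivAt (fun s : ℝ => f (A + s • (B - A))) ((G * (B - A)).trace) 0 :=
    hz_deriv (by simpa using h)
  have := hc.le_slope_of_hasDerivAt (x := 0) (y := 1) (by simp) (by simp) one_pos hd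
  simp [slope_def_field] at this
  linarith

lemma hz_descent {n : ℕ} {f : Matrix (Fin n) (Fin n) ℝ → ℝ}
    {g : Matrix (Fin n) (Fin n) ℝ → Matrix (Fin n) (Fin n) ℝ}
    (hgrad : ∀ X ∈ spectrahedron n, HasFDerivAt f
      (LinearMap.toContinuousLinearMap
        ((Matrix.traceLinearMap (Fin n) ℝ ℝ).comp (LinearMap.mulLeft ℝ (g X)))) X)
    {L : ℝ}
    (hLip : ∀ X ∈ spectrahedron n, ∀ Y ∈ spectrahedron n,
      frobNorm n (g X - g Y) ≤ L * frobNorm n (X - Y))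
    {A B : Matrix (Fin n) (Fin n) ℝ}
    (hA : A ∈ spectrahedron n) (hB : B ∈ spectrahedron n) {γ : ℝ} (hγ : γ ∈ Set.Icc (0 : ℝ) 1) :
    f (A + γ • (B - A)) ≤ f A + γ * (g A * (B - A)).trace
      + γ ^ 2 / 2 * (L * frobNorm n (B - A) ^ 2) := by
  set c := (g A * (B - A)).trace with hc
  set N := frobNorm n (B - A) with hN
  have hd : ∀ t ∈ Set.Icc (0 : ℝ) 1, HasDerivAt
      (fun s : ℝ => f (A + s • (B - A)) - s * c - s ^ 2 / 2 * (L * N ^ 2))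
      ((g (A + t • (B - A)) * (B - A)).trace - c - t * (L * N ^ 2)) t := by
    intro t ht
    have h1 := hz_deriv (hgrad _ (hz_line_mem hA hB ht))
    have h2 := (hasDerivAt_id t).mul_const c
    have h3 := (((hasDerivAt_id t).pow 2).div_const 2).mul_const (L * N ^ 2)
    refine ((h1.sub h2).sub h3).congr_deriv ?_
    simp
  have hanti : AntitoneOn
      (fun s : ℝ => f (A + s • (B - A)) - s * c - s ^ 2 / 2 * (L * N ^ 2)) (Set.Icc (0 : ℝ) 1) := by
    refine antitoneOn_of_deriv_nonpos (convex_Icc _ _)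
      (fun t ht => (hd t ht).continuousAt.continuousWithinAt)
      (fun t ht => (hd t (interior_subset ht)).differentiableAt.differentiableWithinAt) ?_
    intro t ht
    have ht' := interior_subset ht
    rw [(hd t ht').deriv]
    have h1 := hz_trace_mul_le n (g (A + t • (B - A)) - g A) (B - A)
    have h2 := hLip _ (hz_line_mem hA hB ht') _ hA
    have h3 : frobNorm n (A + t • (B - A) - A) = t * N := by
      rw [add_sub_cancel_left, hN, hz_frob_eq, hz_frob_eq, norm_smul, Real.norm_of_nonneg ht'.1]
    rw [h3] at h2
    have hN0 : 0 ≤ N := Real.sqrt_nonneg _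
    rw [Matrix.sub_mul, trace_sub, ← hc] at h1
    have h4 := mul_le_mul_of_nonneg_right h2 hN0
    nlinarith
  have := hanti (Set.left_mem_Icc.2 zero_le_one) hγ hγ.1
  simp at this
  linarith

lemma hz_diam {n : ℕ} {g : Matrix (Fin n) (Fin n) ℝ → Matrix (Fin n) (Fin n) ℝ}
    {L D : ℝ}
    (hLip : ∀ X ∈ spectrahedron n, ∀ Y ∈ spectrahedron n,
      frobNorm n (g X - g Y) ≤ L * frobNorm n (X - Y))
    (hD : D = sSup {d : ℝ | ∃ X ∈ spectrahedron n, ∃ Y ∈ spectrahedron n,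
      d = frobNorm n (X - Y)}) {A B : Matrix (Fin n) (Fin n) ℝ}
    (hA : A ∈ spectrahedron n) (hB : B ∈ spectrahedron n) :
    L * frobNorm n (A - B) ^ 2 ≤ L * D ^ 2 := by
  have hn : ∀ M : Matrix (Fin n) (Fin n) ℝ, 0 ≤ frobNorm n M := fun M => Real.sqrt_nonneg _
  rcases le_or_gt 0 L with hL | hL
  · have hle : frobNorm n (A - B) ≤ D := by
      rw [hD]
      refine le_csSup ⟨2, ?_⟩ ⟨A, hA, B, hB, rfl⟩
      rintro _ ⟨P, hP, Q, hQ, rfl⟩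
      rw [hz_frob_eq]
      linarith [norm_sub_le P Q, hz_norm_le_one hP, hz_norm_le_one hQ]
    have := hn (A - B)
    gcongr
  · have h0 : ∀ P ∈ spectrahedron n, ∀ Q ∈ spectrahedron n, frobNorm n (P - Q) = 0 := by
      intro P hP Q hQ
      have h1 := hLip P hP Q hQ
      have h2 := hn (g P - g Q)
      have h3 := hn (P - Q)
      nlinarith
    have hD0 : D = 0 := by
      rw [hD]
      have : {d : ℝ | ∃ X ∈ spectrahedron n, ∃ Y ∈ spectrahedron n,
          d = frobNorm n (X - Y)} = {0} := by
        ext d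
        constructor
        · rintro ⟨P, hP, Q, hQ, rfl⟩
          exact h0 P hP Q hQ
        · rintro rfl
          exact ⟨A, hA, B, hB, (h0 A hA B hB).symm⟩
      rw [this, csSup_singleton]
    rw [h0 A hA B hB, hD0]

/-- Guarantees of Hazan's Frank–Wolfe algorithm on the spectrahedron: for a convex function
`f` differentiable on `Δ` with gradient `g` (with respect to the Frobenius inner product
`⟨A, B⟩ = Tr(AB)`) that is `L`-Lipschitz on `Δ`, with `D` the Frobenius diameter of `Δ`,
the iterates `X₀ = w wᵀ` (for a unit vector `w`) and
`X_{k+1} = (1 - γₖ) Xₖ + γₖ vₖ vₖᵀ`, where `vₖ` is a unit eigenvector of `g(Xₖ)` for its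
smallest eigenvalue `λₖ` and `γₖ = 2/(k+2)`, satisfy for every `k ≥ 1`:
`Xₖ ⪰ 0`, `Tr(Xₖ) = 1`, `rank(Xₖ) ≤ k + 1`, and
`f(Xₖ) - min_{X ∈ Δ} f(X) ≤ 2 L D² / (k+2)`. -/
theorem hazan_frank_wolfe_guarantees
    (n : ℕ) (f : Matrix (Fin n) (Fin n) ℝ → ℝ) (g : Matrix (Fin n) (Fin n) ℝ → Matrix (Fin n) (Fin n) ℝ)
    (hconv : ConvexOn ℝ (spectrahedron n) f)
    (hgsymm : ∀ X ∈ spectrahedron n, (g X).IsSymm)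
    (hgrad : ∀ X ∈ spectrahedron n, HasFDerivAt f
      (LinearMap.toContinuousLinearMap
        ((Matrix.traceLinearMap (Fin n) ℝ ℝ).comp (LinearMap.mulLeft ℝ (g X)))) X)
    (L : ℝ)
    (hLip : ∀ X ∈ spectrahedron n, ∀ Y ∈ spectrahedron n,
      frobNorm n (g X - g Y) ≤ L * frobNorm n (X - Y))
    (D : ℝ)
    (hD : D = sSup {d : ℝ | ∃ X ∈ spectrahedron n, ∃ Y ∈ spectrahedron n,
      d = frobNorm n (X - Y)})
    (X : ℕ → Matrix (Fin n) (Fin n) ℝ) (w : Fin n → ℝ)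
    (hw : ∑ i, (w i) ^ 2 = 1) (hX0 : X 0 = vecMulVec w w)
    (v : ℕ → Fin n → ℝ) (lam : ℕ → ℝ)
    (hvunit : ∀ k, ∑ i, (v k i) ^ 2 = 1)
    (hveig : ∀ k, g (X k) *ᵥ v k = lam k • v k)
    (hlam : ∀ k, IsLeast {t : ℝ | ∃ u : Fin n → ℝ, u ≠ 0 ∧ g (X k) *ᵥ u = t • u} (lam k))
    (hupd : ∀ k : ℕ, X (k + 1) =
      (1 - 2 / ((k : ℝ) + 2)) • X k + (2 / ((k : ℝ) + 2)) • vecMulVec (v k) (v k)) :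
    ∀ k : ℕ, 1 ≤ k →
      (X k).PosSemidef ∧ (X k).trace = 1 ∧ (X k).rank ≤ k + 1 ∧
      f (X k) - sInf (f '' spectrahedron n) ≤ 2 * L * D ^ 2 / ((k : ℝ) + 2) := by
  have hγ : ∀ k : ℕ, 2 / ((k : ℝ) + 2) ∈ Set.Icc (0 : ℝ) 1 := by
    intro k
    have hk : (0 : ℝ) ≤ k := k.cast_nonneg
    exact ⟨by positivity, by rw [div_le_one (by positivity)]; linarith⟩
  have hupd' : ∀ k : ℕ, X (k + 1) =
      X k + (2 / ((k : ℝ) + 2)) • (vecMulVec (v k) (v k) - X k) := by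
    intro k
    rw [hupd k]
    module
  have hmem : ∀ k, X k ∈ spectrahedron n := by
    intro k
    induction k with
    | zero => rw [hX0]; exact hz_vec_mem hw
    | succ k ih => rw [hupd']; exact hz_line_mem ih (hz_vec_mem (hvunit k)) (hγ k)
  have hrank : ∀ k, (X k).rank ≤ k + 1 := by
    intro k
    induction k with
    | zero => rw [hX0]; exact rank_vecMulVec_le _ _
    | succ k ih =>
      rw [hupd]
      exact (hz_rank _ _ _ _).trans (by omega)
  have hC : 0 ≤ L * D ^ 2 := by
    have := hz_diam hLip hD (hmem 0) (hmem 0)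
    simpa [frobNorm] using this
  have hstep : ∀ Z ∈ spectrahedron n, ∀ k : ℕ, f (X (k + 1)) - f Z ≤
      (1 - 2 / ((k : ℝ) + 2)) * (f (X k) - f Z)
        + (2 / ((k : ℝ) + 2)) ^ 2 / 2 * (L * D ^ 2) := by
    intro Z hZ k
    have hV := hz_vec_mem (hvunit k)
    have h1 := hz_descent hgrad hLip (hmem k) hV (hγ k)
    rw [← hupd'] at h1
    have h2 := hz_first_order hconv (hmem k) hZ (hgrad _ (hmem k))
    have h3 := hz_diam hLip hD hV (hmem k)
    have h4 := hz_lam_le (hgsymm _ (hmem k))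
      (fun t u hu ht => (hlam k).2 ⟨u, hu, ht⟩) hZ
    have h5 : (g (X k) * vecMulVec (v k) (v k)).trace = lam k := by
      rw [mul_vecMulVec, hveig, trace_vecMulVec, smul_dotProduct]
      have : v k ⬝ᵥ v k = 1 := by
        rw [← hvunit k]
        simp [dotProduct, sq]
      simp [this]
    rw [Matrix.mul_sub, trace_sub] at h1 h2
    rw [h5] at h1
    have h6 := mul_le_mul_of_nonneg_left h3
      (show 0 ≤ (2 / ((k : ℝ) + 2)) ^ 2 / 2 by positivity)
    have h7 : 2 / ((k : ℝ) + 2) * (lam k - (g (X k) * X k).trace) ≤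
        2 / ((k : ℝ) + 2) * (f Z - f (X k)) :=
      mul_le_mul_of_nonneg_left (by linarith) (hγ k).1
    linarith
  have hrate : ∀ Z ∈ spectrahedron n, ∀ k : ℕ,
      f (X (k + 1)) - f Z ≤ 2 * (L * D ^ 2) / ((k : ℝ) + 3) := by
    intro Z hZ k
    induction k with
    | zero =>
      have := hstep Z hZ 0
      norm_num at this ⊢
      linarith
    | succ k ih =>
      have h := hstep Z hZ (k + 1)
      have hk : (0 : ℝ) ≤ k := k.cast_nonneg
      have h1 := mul_le_mul_of_nonneg_left ih (sub_nonneg.2 (hγ (k + 1)).2)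
      refine h.trans ((add_le_add_left h1 _).trans ?_)
      push_cast
      generalize L * D ^ 2 = C at hC
      have e : (1 - 2 / ((k : ℝ) + 1 + 2)) * (2 * C / (k + 3)) + (2 / ((k : ℝ) + 1 + 2)) ^ 2 / 2 * C
          = 2 * C * ((k + 2) / (k + 3) ^ 2) := by
        rw [show (k : ℝ) + 1 + 2 = k + 3 by ring]
        field_simp
        ring
      rw [e, div_eq_mul_one_div (2 * C)]
      refine mul_le_mul_of_nonneg_left ?_ (by positivity)
      rw [div_le_div_iff₀ (by positivity) (by positivity)]
      nlinarith
  intro k hk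
  refine ⟨(hmem k).1, (hmem k).2, hrank k, ?_⟩
  obtain ⟨m, rfl⟩ : ∃ m, k = m + 1 := ⟨k - 1, by omega⟩
  have : f (X (m + 1)) - 2 * (L * D ^ 2) / ((m : ℝ) + 3) ≤ sInf (f '' spectrahedron n) := by
    refine le_csInf ⟨_, X 0, hmem 0, rfl⟩ ?_
    rintro _ ⟨Z, hZ, rfl⟩
    linarith [hrate Z hZ m]
  have e : 2 * L * D ^ 2 / (((m + 1 : ℕ) : ℝ) + 2) = 2 * (L * D ^ 2) / ((m : ℝ) + 3) := by
    push_cast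
    congr 1 <;> ring
  rw [e]
  linarith
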